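/- Probabilistic ready trace equivalence ≈_O is a congruence for all CSP_p operators: if p ≈_O p̄ then C[p] ≈_O C[p̄] for every CSP_p context C[·]. -/

import Mathlib

inductive Proc (A : Type) where
  | nd : List (A × Proc A) → Proc A
  | pr : List (ℝ × Proc A) → Proc A

namespace Proc

variable {A : Type} [DecidableEq A]

/-- The menu of a nondeterministic state: the set of initially enabled actions. -/
def menu : Proc A → Finset A
  | nd l => (l.map Prod.fst).toFinset
  | pr _ => ∅

/-- Deterministic action transition. -/
def step : Proc A → A → Option (Proc A)
  | nd l, a => (l.find? (fun x => x.1 = a)).map Prod.snd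
  | pr _, _ => none

/-- P¹ₛ(M) : the probability that the initial menu observed is M. -/
noncomputable def P1 : Proc A → Finset A → ℝ
  | nd l, M => if (l.map Prod.fst).toFinset = M then 1 else 0
  | pr l, M => (l.attach.map (fun x => x.1.1 * P1 x.1.2 M)).sum
termination_by p _ => sizeOf p
decreasing_by
  obtain ⟨⟨r, p⟩, hmem⟩ := x
  have h := List.sizeOf_lt_of_mem hmem
  simp at h ⊢
  omega

end Proc
/-- Flattening used when a probabilistic transition would lead to a probabilistic state. -/
def flat {A : Type} (w : ℝ) : Proc A → List (ℝ × Proc A)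
  | Proc.pr l => l.map (fun x => (w * x.1, x.2))
  | q => [(w, q)]

namespace Proc

variable {A : Type} [DecidableEq A]

/-- The derived process s_{(M,a)} : the process that `s` becomes, given that the
menu `M` was offered and the action `a ∈ M` was performed. -/
noncomputable def after : Proc A → Finset A → A → Option (Proc A)
  | nd l, M, a => if (l.map Prod.fst).toFinset = M then step (nd l) a else none
  | pr l, M, a =>
      let sel := l.filter (fun x => x.2.menu = M)
      let tot := (sel.map Prod.fst).sum
      let entries := sel.flatMap (fun x =>
        match x.2.step a with
        | none => []
        | some q => flat (x.1 / tot) q)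
      if entries.isEmpty then none else some (pr entries)

/-- The conditional ready-trace probability
`P_sⁿ(M | M₁,a₁,…,a_{n-1})`, where `none` represents undefinedness. -/
noncomputable def Pn : Proc A → List (Finset A × A) → Finset A → Option ℝ
  | s, [], M => some (P1 s M)
  | s, Ma :: rest, M =>
      if 0 < P1 s Ma.1 then (after s Ma.1 Ma.2).bind (fun s' => Pn s' rest M)
      else none

/-- Probabilistic ready trace equivalence `≈_O`. -/
noncomputable def RTEquiv (s t : Proc A) : Prop :=
  ∀ (tr : List (Finset A × A)) (M : Finset A), Pn s tr M = Pn t tr M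

/-- Well-formed process graphs: action-deterministic menus, probabilities in (0,1]
summing to one, and probabilistic transitions leading to nondeterministic states. -/
inductive WF : Proc A → Prop
  | nd (l : List (A × Proc A)) :
      (l.map Prod.fst).Nodup → (∀ x ∈ l, WF x.2) → WF (.nd l)
  | pr (l : List (ℝ × Proc A)) :
      (∀ x ∈ l, 0 < x.1 ∧ x.1 ≤ 1 ∧ ∃ l', x.2 = Proc.nd l') →
      (l.map Prod.fst).sum = 1 →
      (∀ x ∈ l, WF x.2) → WF (.pr l)

end Proc
/-- Syntax of the algebra CSP_p: empty process, action-guarded external choice,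
probabilistic choice, priority, lock-step parallel and parallel with
synchronization set L. -/
inductive CSPp (A : Type) where
  | delta : CSPp A
  | ext : List (A × CSPp A) → CSPp A
  | prob : List (ℝ × CSPp A) → CSPp A
  | theta : CSPp A → CSPp A
  | par : CSPp A → CSPp A → CSPp A
  | parL : Finset A → CSPp A → CSPp A → CSPp A

namespace Proc

variable {A : Type} [DecidableEq A]

/-- Flattening of a probabilistic branch, so that probabilistic transitions
lead to nondeterministic states. -/
def pflat (x : ℝ × Proc A) : List (ℝ × Proc A) :=
  match x.2 with
  | .pr l' => l'.map (fun z => (x.1 * z.1, z.2))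
  | q => [(x.1, q)]

variable [LT A] [DecidableRel ((· < ·) : A → A → Prop)]

/-- The list of branches of a menu that have maximal priority. -/
def maxBranches (l : List (A × Proc A)) : List (A × Proc A) :=
  l.filter (fun x => decide (¬ ∃ y ∈ l, x.1 < y.1))

/-- The priority operator Θ on process graphs: keep only the maximal-priority
actions of each menu. -/
inductive ThetaRel : Proc A → Proc A → Prop
  | nd (l m : List (A × Proc A)) :
      m.length = (maxBranches l).length →
      (∀ i (hi : i < (maxBranches l).length) (hi' : i < m.length),
        (m.get ⟨i, hi'⟩).1 = ((maxBranches l).get ⟨i, hi⟩).1) →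
      (∀ i (hi : i < (maxBranches l).length) (hi' : i < m.length),
        ThetaRel ((maxBranches l).get ⟨i, hi⟩).2 (m.get ⟨i, hi'⟩).2) →
      ThetaRel (.nd l) (.nd m)
  | pr (l m : List (ℝ × Proc A)) :
      m.length = l.length →
      (∀ i (hi : i < l.length) (hi' : i < m.length),
        (m.get ⟨i, hi'⟩).1 = (l.get ⟨i, hi⟩).1) →
      (∀ i (hi : i < l.length) (hi' : i < m.length),
        ThetaRel (l.get ⟨i, hi⟩).2 (m.get ⟨i, hi'⟩).2) →
      ThetaRel (.pr l) (.pr m)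

/-- The branches of `l` whose action is in `L` and can be matched by the menu `l'`. -/
def syncBranches (L : Finset A) (l l' : List (A × Proc A)) : List (A × Proc A) :=
  l.filter (fun x => decide (x.1 ∈ L) && (Proc.step (.nd l') x.1).isSome)

/-- The branches of `l` whose action is interleaved (not in `L`). -/
def freeBranches (L : Finset A) (l : List (A × Proc A)) : List (A × Proc A) :=
  l.filter (fun x => decide (x.1 ∉ L))

/-- `ParRel L p q r` : `r` is the parallel composition of `p` and `q` that
synchronizes on the actions in `L` and interleaves all other actions. -/
inductive ParRel (L : Finset A) : Proc A → Proc A → Proc A → Prop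
  | ndnd (l l' : List (A × Proc A)) (m₁ m₂ m₃ : List (A × Proc A)) :
      m₁.length = (syncBranches L l l').length →
      (∀ i (hi : i < (syncBranches L l l').length) (hi' : i < m₁.length),
        (m₁.get ⟨i, hi'⟩).1 = ((syncBranches L l l').get ⟨i, hi⟩).1) →
      (∀ i (hi : i < (syncBranches L l l').length) (hi' : i < m₁.length) q',
        Proc.step (.nd l') ((syncBranches L l l').get ⟨i, hi⟩).1 = some q' →
        ParRel L ((syncBranches L l l').get ⟨i, hi⟩).2 q' (m₁.get ⟨i, hi'⟩).2) →
      m₂.length = (freeBranches L l).length →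
      (∀ i (hi : i < (freeBranches L l).length) (hi' : i < m₂.length),
        (m₂.get ⟨i, hi'⟩).1 = ((freeBranches L l).get ⟨i, hi⟩).1) →
      (∀ i (hi : i < (freeBranches L l).length) (hi' : i < m₂.length),
        ParRel L ((freeBranches L l).get ⟨i, hi⟩).2 (.nd l') (m₂.get ⟨i, hi'⟩).2) →
      m₃.length = (freeBranches L l').length →
      (∀ i (hi : i < (freeBranches L l').length) (hi' : i < m₃.length),
        (m₃.get ⟨i, hi'⟩).1 = ((freeBranches L l').get ⟨i, hi⟩).1) →
      (∀ i (hi : i < (freeBranches L l').length) (hi' : i < m₃.length),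
        ParRel L (.nd l) ((freeBranches L l').get ⟨i, hi⟩).2 (m₃.get ⟨i, hi'⟩).2) →
      ParRel L (.nd l) (.nd l') (.nd (m₁ ++ m₂ ++ m₃))
  | prnd (l : List (ℝ × Proc A)) (q : Proc A) (m : List (ℝ × Proc A)) :
      (∀ l', q ≠ .pr l') →
      m.length = l.length →
      (∀ i (hi : i < l.length) (hi' : i < m.length),
        (m.get ⟨i, hi'⟩).1 = (l.get ⟨i, hi⟩).1) →
      (∀ i (hi : i < l.length) (hi' : i < m.length),
        ParRel L (l.get ⟨i, hi⟩).2 q (m.get ⟨i, hi'⟩).2) →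
      ParRel L (.pr l) q (.pr m)
  | ndpr (q : Proc A) (l' : List (ℝ × Proc A)) (m : List (ℝ × Proc A)) :
      (∀ l'', q ≠ .pr l'') →
      m.length = l'.length →
      (∀ i (hi : i < l'.length) (hi' : i < m.length),
        (m.get ⟨i, hi'⟩).1 = (l'.get ⟨i, hi⟩).1) →
      (∀ i (hi : i < l'.length) (hi' : i < m.length),
        ParRel L q (l'.get ⟨i, hi⟩).2 (m.get ⟨i, hi'⟩).2) →
      ParRel L q (.pr l') (.pr m)
  | prpr (l l' : List (ℝ × Proc A)) (m : List (ℝ × Proc A)) :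
      m.length = (l.flatMap (fun x => l'.map (fun x' => (x, x')))).length →
      (∀ i (hi : i < (l.flatMap (fun x => l'.map (fun x' => (x, x')))).length)
          (hi' : i < m.length),
        (m.get ⟨i, hi'⟩).1 =
          ((l.flatMap (fun x => l'.map (fun x' => (x, x')))).get ⟨i, hi⟩).1.1 *
          ((l.flatMap (fun x => l'.map (fun x' => (x, x')))).get ⟨i, hi⟩).2.1) →
      (∀ i (hi : i < (l.flatMap (fun x => l'.map (fun x' => (x, x')))).length)
          (hi' : i < m.length),
        ParRel L ((l.flatMap (fun x => l'.map (fun x' => (x, x')))).get ⟨i, hi⟩).1.2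
          ((l.flatMap (fun x => l'.map (fun x' => (x, x')))).get ⟨i, hi⟩).2.2
          (m.get ⟨i, hi'⟩).2) →
      ParRel L (.pr l) (.pr l') (.pr m)

variable [Fintype A]

/-- `Den p q` : the process graph `q` is the operational-semantics denotation of
the CSP_p term `p` (per the SOS rules of the paper). -/
inductive Den : CSPp A → Proc A → Prop
  | delta : Den .delta (.nd [])
  | ext (l : List (A × CSPp A)) (m : List (A × Proc A)) :
      m.length = l.length →
      (∀ i (hi : i < l.length) (hi' : i < m.length),
        (m.get ⟨i, hi'⟩).1 = (l.get ⟨i, hi⟩).1) →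
      (∀ i (hi : i < l.length) (hi' : i < m.length),
        Den (l.get ⟨i, hi⟩).2 (m.get ⟨i, hi'⟩).2) →
      Den (.ext l) (.nd m)
  | prob (l : List (ℝ × CSPp A)) (m : List (ℝ × Proc A)) :
      m.length = l.length →
      (∀ i (hi : i < l.length) (hi' : i < m.length),
        (m.get ⟨i, hi'⟩).1 = (l.get ⟨i, hi⟩).1) →
      (∀ i (hi : i < l.length) (hi' : i < m.length),
        Den (l.get ⟨i, hi⟩).2 (m.get ⟨i, hi'⟩).2) →
      Den (.prob l) (.pr (m.flatMap pflat))
  | theta (p : CSPp A) (q q' : Proc A) :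
      Den p q → ThetaRel q q' → Den (.theta p) q'
  | par (p₁ p₂ : CSPp A) (q₁ q₂ r : Proc A) :
      Den p₁ q₁ → Den p₂ q₂ → ParRel Finset.univ q₁ q₂ r → Den (.par p₁ p₂) r
  | parL (L : Finset A) (p₁ p₂ : CSPp A) (q₁ q₂ r : Proc A) :
      Den p₁ q₁ → Den p₂ q₂ → ParRel L q₁ q₂ r → Den (.parL L p₁ p₂) r

/-- Probabilistic ready trace equivalence `≈_O` on CSP_p terms. -/
def CSPEquiv (s t : CSPp A) : Prop :=
  ∀ ps pt : Proc A, Den s ps → Den t pt → RTEquiv ps pt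

end Proc

namespace CSPp

variable {A : Type}

/-- Well-formed CSP_p terms: distinct actions in external choices and
probabilities in (0,1] summing to one in probabilistic choices. -/
inductive WFt : CSPp A → Prop
  | delta : WFt .delta
  | ext (l : List (A × CSPp A)) :
      (l.map Prod.fst).Nodup → (∀ x ∈ l, WFt x.2) → WFt (.ext l)
  | prob (l : List (ℝ × CSPp A)) :
      (∀ x ∈ l, 0 < x.1 ∧ x.1 ≤ 1) → (l.map Prod.fst).sum = 1 →
      (∀ x ∈ l, WFt x.2) → WFt (.prob l)
  | theta (p : CSPp A) : WFt p → WFt (.theta p)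
  | par (p q : CSPp A) : WFt p → WFt q → WFt (.par p q)
  | parL (L : Finset A) (p q : CSPp A) : WFt p → WFt q → WFt (.parL L p q)

end CSPp

namespace CSPp

/-- One-hole contexts of CSP_p. -/
inductive Ctx (A : Type) where
  | hole : Ctx A
  | ext : List (A × CSPp A) → A → Ctx A → List (A × CSPp A) → Ctx A
  | prob : List (ℝ × CSPp A) → ℝ → Ctx A → List (ℝ × CSPp A) → Ctx A
  | theta : Ctx A → Ctx A
  | parl : Ctx A → CSPp A → Ctx A
  | parr : CSPp A → Ctx A → Ctx A
  | parLl : Finset A → Ctx A → CSPp A → Ctx A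
  | parLr : Finset A → CSPp A → Ctx A → Ctx A

/-- Filling the hole of a context with a process. -/
def Ctx.fill {A : Type} : Ctx A → CSPp A → CSPp A
  | .hole, p => p
  | .ext pre a c suf, p => .ext (pre ++ (a, c.fill p) :: suf)
  | .prob pre w c suf, p => .prob (pre ++ (w, c.fill p) :: suf)
  | .theta c, p => .theta (c.fill p)
  | .parl c q, p => .par (c.fill p) q
  | .parr q c, p => .par q (c.fill p)
  | .parLl L c q, p => .parL L (c.fill p) q
  | .parLr L q c, p => .parL L q (c.fill p)

end CSPp

namespace Proc

/-- Real-valued functionals on ready traces: a list of observed menus and performed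
actions, followed by a final menu. -/
abbrev Obs (A : Type) := List (Finset A × A) → Finset A → ℝ

section Preliminaries

variable {A : Type}

/-- The functional of the derived state after menu `M` and action `a`, unnormalized. -/
def derive (F : Obs A) (M : Finset A) (a : A) : Obs A :=
  fun tr N => F ((M, a) :: tr) N

theorem derive_zero (M : Finset A) (a : A) : derive (0 : Obs A) M a = 0 := rfl

theorem derive_add (F G : Obs A) (M : Finset A) (a : A) :
    derive (F + G) M a = derive F M a + derive G M a := rfl

theorem derive_smul (c : ℝ) (F : Obs A) (M : Finset A) (a : A) :
    derive (c • F) M a = c • derive F M a := rfl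

theorem list_sum_apply {ι : Type*} (l : List ι) (f : ι → Obs A)
    (tr : List (Finset A × A)) (N : Finset A) :
    (l.map f).sum tr N = (l.map (fun x => f x tr N)).sum := by
  induction l with
  | nil => rfl
  | cons x l ih => simp [← ih]

theorem sum_eq_of_forall₂ {ι κ : Type*} {f : ι → Obs A} {g : κ → Obs A} {l : List ι} {m : List κ}
    (h : List.Forall₂ (fun x y => g y = f x) l m) : (m.map g).sum = (l.map f).sum := by
  induction h with
  | nil => rfl
  | cons hxy _ ih => simp [hxy, ih]

theorem sum_map_filter {ι : Type*} (p : ι → Prop) [DecidablePred p] (f g : ι → ℝ) (l : List ι)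
    (hf : ∀ x ∈ l, f x = if p x then g x else 0) :
    (l.map f).sum = ((l.filter (fun x => decide (p x))).map g).sum := by
  induction l with
  | nil => rfl
  | cons x l ih =>
    rw [List.map_cons, List.sum_cons, ih fun y hy => hf y (List.mem_cons_of_mem _ hy),
      hf x List.mem_cons_self, List.filter_cons]
    by_cases hx : p x <;> simp [hx]

/-- Structural sanity of process graphs: probabilistic states have at least one branch,
positive weights, and nondeterministic successors. -/
inductive Good : Proc A → Prop
  | nd (l : List (A × Proc A)) : (∀ x ∈ l, Good x.2) → Good (.nd l)
  | pr (l : List (ℝ × Proc A)) : l ≠ [] →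
      (∀ x ∈ l, 0 < x.1) → (∀ x ∈ l, ∃ l', x.2 = Proc.nd l') →
      (∀ x ∈ l, Good x.2) → Good (.pr l)

theorem Good.flat_ne_nil {q : Proc A} (h : Good q) (w : ℝ) : flat w q ≠ [] := by
  cases h with
  | nd l _ => simp [flat]
  | pr l hl _ _ _ => simpa [flat] using hl

theorem Good.of_mem_flat {q : Proc A} (h : Good q) {w : ℝ} (hw : 0 < w) {x : ℝ × Proc A}
    (hx : x ∈ flat w q) : 0 < x.1 ∧ (∃ l', x.2 = .nd l') ∧ Good x.2 := by
  cases h with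
  | nd l h =>
    rw [flat, List.mem_singleton] at hx
    · subst hx
      exact ⟨hw, ⟨l, rfl⟩, .nd l h⟩
    · simp
  | pr l _ hp hn hg =>
    simp only [flat, List.mem_map] at hx
    obtain ⟨y, hy, rfl⟩ := hx
    exact ⟨mul_pos hw (hp y hy), hn y hy, hg y hy⟩

theorem Good.nd_of_get {m : List (A × Proc A)}
    (h : ∀ i (hi : i < m.length), Good (m.get ⟨i, hi⟩).2) : Good (.nd m) := by
  refine .nd m fun x hx => ?_
  obtain ⟨⟨i, hi⟩, rfl⟩ := List.mem_iff_get.1 hx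
  exact h i hi

theorem Good.pr_of_get {m : List (ℝ × Proc A)} (hm : 0 < m.length)
    (h : ∀ i (hi : i < m.length), 0 < (m.get ⟨i, hi⟩).1 ∧
      (∃ l', (m.get ⟨i, hi⟩).2 = .nd l') ∧ Good (m.get ⟨i, hi⟩).2) : Good (.pr m) := by
  have h' : ∀ x ∈ m, 0 < x.1 ∧ (∃ l', x.2 = .nd l') ∧ Good x.2 := by
    intro x hx
    obtain ⟨⟨i, hi⟩, rfl⟩ := List.mem_iff_get.1 hx
    exact h i hi
  exact .pr m (List.ne_nil_of_length_pos hm) (fun x hx => (h' x hx).1) (fun x hx => (h' x hx).2.1)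
    (fun x hx => (h' x hx).2.2)

theorem Good.pr_flatMap_pflat {m : List (ℝ × Proc A)} (hm : m ≠ [])
    (hpos : ∀ x ∈ m, 0 < x.1) (hg : ∀ x ∈ m, Good x.2) : Good (.pr (m.flatMap pflat)) := by
  have hflat : ∀ x : ℝ × Proc A, pflat x = flat x.1 x.2 := by
    rintro ⟨w, l | l⟩ <;> rfl
  have hmem : ∀ y ∈ m.flatMap pflat, 0 < y.1 ∧ (∃ l', y.2 = .nd l') ∧ Good y.2 := by
    intro y hy
    obtain ⟨x, hx, hyx⟩ := List.mem_flatMap.1 hy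
    rw [hflat] at hyx
    exact (hg x hx).of_mem_flat (hpos x hx) hyx
  refine .pr _ ?_ (fun y hy => (hmem y hy).1) (fun y hy => (hmem y hy).2.1)
    (fun y hy => (hmem y hy).2.2)
  obtain ⟨x, hx⟩ := List.exists_mem_of_ne_nil _ hm
  intro h0
  have := List.flatMap_eq_nil_iff.1 h0 x hx
  rw [hflat] at this
  exact (hg x hx).flat_ne_nil _ this

theorem ThetaRel.exists_nd [LT A] [DecidableRel ((· < ·) : A → A → Prop)]
    {p r : Proc A} (h : ThetaRel p r) (hp : ∃ l, p = .nd l) : ∃ m, r = .nd m := by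
  obtain ⟨l, rfl⟩ := hp
  cases h
  exact ⟨_, rfl⟩

theorem ThetaRel.good [LT A] [DecidableRel ((· < ·) : A → A → Prop)]
    {p r : Proc A} (h : ThetaRel p r) (hp : Good p) : Good r := by
  induction h with
  | nd l m hlen _ _ ih =>
    cases hp with | nd _ hl =>
    refine .nd_of_get fun i hi => ?_
    have hi' : i < (maxBranches l).length := hlen ▸ hi
    exact ih i hi' hi (hl _ (List.mem_filter.1 (List.get_mem _ _)).1)
  | pr l m hlen hw hrel ih =>
    cases hp with | pr _ hne hpos hnd hg =>
    refine .pr_of_get (hlen ▸ List.length_pos_of_ne_nil hne) fun i hi => ?_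
    have hi' : i < l.length := hlen ▸ hi
    have hx := List.get_mem l ⟨i, hi'⟩
    exact ⟨hw i hi' hi ▸ hpos _ hx, (hrel i hi' hi).exists_nd (hnd _ hx), ih i hi' hi (hg _ hx)⟩

end Preliminaries

section Weight

variable {A : Type} [DecidableEq A]

/-- The joint (unconditional) probability that the menus of a ready trace are observed
when its actions are performed. -/
noncomputable def weight : Proc A → List (Finset A × A) → Finset A → ℝ
  | nd l, [], N => if menu (nd l) = N then 1 else 0
  | nd l, Ma :: tr, N =>
      if menu (nd l) = Ma.1 then
        match step (nd l) Ma.2 with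
        | none => 0
        | some q => weight q tr N
      else 0
  | pr l, tr, N => (l.attach.map (fun x => x.1.1 * weight x.1.2 tr N)).sum
termination_by s tr _ => (tr.length, sizeOf s)
decreasing_by
  · simp [Prod.lex_def]
  · obtain ⟨⟨r, p⟩, hmem⟩ := x
    have h := List.sizeOf_lt_of_mem hmem
    simp [Prod.lex_def] at h ⊢
    omega

/-- The functional restricted to traces whose first menu is `M`. -/
def restr (F : Obs A) (M : Finset A) : Obs A
  | [], N => if M = N then F [] N else 0
  | Ma :: tr, N => if M = Ma.1 then F (Ma :: tr) N else 0

theorem P1_nd (l : List (A × Proc A)) (M : Finset A) :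
    P1 (nd l) M = if menu (nd l) = M then 1 else 0 := by
  rw [P1]
  rfl

theorem P1_pr (l : List (ℝ × Proc A)) (M : Finset A) :
    P1 (pr l) M = (l.map (fun x => x.1 * P1 x.2 M)).sum := by
  rw [P1]
  congr 1
  exact List.attach_map_val (l := l) (f := fun x => x.1 * P1 x.2 M)

theorem weight_pr_apply (l : List (ℝ × Proc A)) (tr : List (Finset A × A)) (N : Finset A) :
    weight (pr l) tr N = (l.map (fun x => x.1 * weight x.2 tr N)).sum := by
  rw [weight]
  congr 1
  exact List.attach_map_val (l := l) (f := fun x => x.1 * weight x.2 tr N)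

theorem weight_pr (l : List (ℝ × Proc A)) :
    weight (pr l) = (l.map (fun x => x.1 • weight x.2)).sum := by
  funext tr N
  rw [weight_pr_apply, list_sum_apply]
  rfl

theorem weight_nd_nil (l : List (A × Proc A)) (N : Finset A) :
    weight (nd l) [] N = if menu (nd l) = N then 1 else 0 := by
  rw [weight]

theorem weight_nd_cons (l : List (A × Proc A)) (M : Finset A) (a : A)
    (tr : List (Finset A × A)) (N : Finset A) :
    weight (nd l) ((M, a) :: tr) N =
      if menu (nd l) = M then (step (nd l) a).elim (0 : Obs A) weight tr N else 0 := by
  rw [weight]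
  cases step (nd l) a <;> rfl

theorem derive_weight_nd (l : List (A × Proc A)) (M : Finset A) (a : A) :
    derive (weight (nd l)) M a =
      if menu (nd l) = M then (step (nd l) a).elim (0 : Obs A) weight else 0 := by
  funext tr N
  rw [derive, weight_nd_cons]
  split_ifs <;> rfl

theorem restr_weight_nd (l : List (A × Proc A)) (M : Finset A) :
    restr (weight (nd l)) M = if menu (nd l) = M then weight (nd l) else 0 := by
  funext tr N
  rcases tr with _ | ⟨⟨M', a⟩, tr⟩
  · rw [restr, weight_nd_nil]
    split_ifs <;> simp_all [weight_nd_nil]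
  · rw [restr, weight_nd_cons]
    split_ifs <;> simp_all [weight_nd_cons]

theorem restr_zero (M : Finset A) : restr (0 : Obs A) M = 0 := by
  funext tr N
  cases tr <;> simp [restr]

theorem restr_add (F G : Obs A) (M : Finset A) :
    restr (F + G) M = restr F M + restr G M := by
  funext tr N
  cases tr <;> simp only [restr, Pi.add_apply] <;> split_ifs <;> simp

theorem restr_smul (c : ℝ) (F : Obs A) (M : Finset A) :
    restr (c • F) M = c • restr F M := by
  funext tr N
  cases tr <;> simp only [restr, Pi.smul_apply] <;> split_ifs <;> simp

end Weight

section Step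

variable {A : Type} [DecidableEq A]

theorem step_nil (a : A) : step (nd []) a = none := rfl

theorem step_cons (x : A × Proc A) (l : List (A × Proc A)) (a : A) :
    step (nd (x :: l)) a = if x.1 = a then some x.2 else step (nd l) a := by
  by_cases h : x.1 = a <;> simp [step, h]

theorem step_append (l l' : List (A × Proc A)) (a : A) :
    step (nd (l ++ l')) a = (step (nd l) a).or (step (nd l') a) := by
  induction l with
  | nil => simp [step_nil]
  | cons x l ih =>
    rw [List.cons_append, step_cons, step_cons, ih]
    split_ifs <;> rfl

theorem step_filter (P : A → Bool) (l : List (A × Proc A)) (a : A) :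
    step (nd (l.filter (fun x => P x.1))) a = if P a then step (nd l) a else none := by
  induction l with
  | nil => simp [step_nil]
  | cons x l ih =>
    rw [List.filter_cons]
    by_cases hx : x.1 = a
    · subst hx
      cases hP : P x.1 <;> simp_all [step_cons]
    · cases hP : P x.1 <;> simp [step_cons, hx, ih]

theorem mem_menu_iff (l : List (A × Proc A)) (a : A) :
    a ∈ menu (nd l) ↔ (step (nd l) a).isSome := by
  induction l with
  | nil => simp [menu, step_nil]
  | cons x l ih =>
    rw [step_cons]
    by_cases h : x.1 = a
    · simp [menu, h]
    · rw [if_neg h, ← ih]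
      simp [menu, Ne.symm h]

theorem step_eq_none_iff (l : List (A × Proc A)) (a : A) :
    step (nd l) a = none ↔ a ∉ menu (nd l) := by
  rw [mem_menu_iff]
  simp

theorem mem_of_step_eq_some {l : List (A × Proc A)} {a : A} {q : Proc A}
    (h : step (nd l) a = some q) : (a, q) ∈ l := by
  induction l with
  | nil => simp [step_nil] at h
  | cons x l ih =>
    rw [step_cons] at h
    split_ifs at h with hx
    · subst hx
      cases h
      simp
    · exact List.mem_cons_of_mem _ (ih h)

theorem menu_eq_of_forall₂ {R : A × Proc A → A × Proc A → Prop}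
    {l m : List (A × Proc A)} (h : List.Forall₂ R l m) (hR : ∀ x y, R x y → y.1 = x.1) :
    menu (nd m) = menu (nd l) := by
  have : m.map Prod.fst = l.map Prod.fst := by
    induction h with
    | nil => rfl
    | cons hxy _ ih => simp [hR _ _ hxy, ih]
  rw [menu, menu, this]

theorem step_of_forall₂ {R : A → Proc A → Proc A → Prop} {l m : List (A × Proc A)}
    (h : List.Forall₂ (fun x y => y.1 = x.1 ∧ R x.1 x.2 y.2) l m) (a : A) :
    (step (nd l) a = none ∧ step (nd m) a = none) ∨
      ∃ q q', step (nd l) a = some q ∧ step (nd m) a = some q' ∧ R a q q' := by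
  induction h with
  | nil => exact Or.inl ⟨rfl, rfl⟩
  | @cons x y l m hxy _ ih =>
    rw [step_cons, step_cons, hxy.1]
    split_ifs with hx
    · subst hx
      exact Or.inr ⟨_, _, rfl, rfl, hxy.2⟩
    · exact ih

theorem weight_nd_congr {m m' : List (A × Proc A)}
    (h : List.Forall₂ (fun x y => y.1 = x.1 ∧ weight x.2 = weight y.2) m m') :
    weight (nd m) = weight (nd m') := by
  have hmenu := menu_eq_of_forall₂ h fun _ _ h => h.1
  funext tr N
  rcases tr with _ | ⟨⟨M, a⟩, tr⟩
  · rw [weight_nd_nil, weight_nd_nil, hmenu]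
  · rw [weight_nd_cons, weight_nd_cons, hmenu]
    rcases step_of_forall₂ (R := fun _ p q => weight p = weight q) h a with
      ⟨h₁, h₂⟩ | ⟨q, q', h₁, h₂, hq⟩
    · rw [h₁, h₂]
    · rw [h₁, h₂, Option.elim_some, Option.elim_some, hq]

theorem weight_pr_flatMap_pflat (m : List (ℝ × Proc A)) :
    weight (pr (m.flatMap pflat)) = (m.map (fun x => x.1 • weight x.2)).sum := by
  rw [weight_pr]
  induction m with
  | nil => rfl
  | cons x m ih =>
    rw [List.flatMap_cons, List.map_append, List.sum_append, ih, List.map_cons, List.sum_cons]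
    congr 1
    obtain ⟨w, l | l⟩ := x
    · simp [pflat]
    · simp [pflat, weight_pr, List.smul_sum, Function.comp_def, mul_smul]

end Step

section ConditionalProbability

variable {A : Type} [DecidableEq A]

theorem Good.of_step {l : List (A × Proc A)} (h : Good (.nd l)) {a : A} {q : Proc A}
    (hq : step (.nd l) a = some q) : Good q := by
  cases h with
  | nd _ h => exact h _ (mem_of_step_eq_some hq)

theorem Good.weight_nil {s : Proc A} (h : Good s) (M : Finset A) :
    weight s [] M = P1 s M := by
  induction h with
  | nd l _ _ => rw [weight_nd_nil, P1_nd]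
  | pr l _ _ _ _ ih =>
    rw [weight_pr_apply, P1_pr]
    congr 1
    exact List.map_congr_left fun x hx => by rw [ih x hx]

theorem weight_pr_flat (w : ℝ) (q : Proc A) (tr : List (Finset A × A)) (N : Finset A) :
    ((flat w q).map (fun x => x.1 * weight x.2 tr N)).sum = w * weight q tr N := by
  cases q with
  | nd l => simp [flat]
  | pr l => simp [flat, weight_pr_apply, ← List.sum_map_mul_left, mul_assoc, Function.comp_def]

theorem Good.P1_pr_eq {l : List (ℝ × Proc A)} (h : Good (.pr l)) (M : Finset A) :
    P1 (.pr l) M = ((l.filter (fun x => x.2.menu = M)).map Prod.fst).sum := by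
  cases h with
  | pr _ _ _ hn _ =>
    rw [P1_pr]
    refine sum_map_filter (fun x : ℝ × Proc A => x.2.menu = M) _ _ _ fun x hx => ?_
    obtain ⟨l', hl'⟩ := hn x hx
    rw [hl', P1_nd]
    split_ifs <;> simp

theorem Good.weight_pr_cons {l : List (ℝ × Proc A)} (h : Good (.pr l)) (M : Finset A) (a : A)
    (tr : List (Finset A × A)) (N : Finset A) :
    weight (.pr l) ((M, a) :: tr) N =
      ((l.filter (fun x => x.2.menu = M)).map
        (fun x => x.1 * (step x.2 a).elim (0 : Obs A) weight tr N)).sum := by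
  cases h with
  | pr _ _ _ hn _ =>
    rw [weight_pr_apply]
    refine sum_map_filter (fun x : ℝ × Proc A => x.2.menu = M) _ _ _ fun x hx => ?_
    obtain ⟨l', hl'⟩ := hn x hx
    rw [hl', weight_nd_cons]
    split_ifs <;> simp

theorem Good.filter_menu_ne_nil {l : List (ℝ × Proc A)} (h : Good (.pr l)) {M : Finset A}
    (hM : 0 < P1 (.pr l) M) : l.filter (fun x => x.2.menu = M) ≠ [] := by
  intro h0
  rw [h.P1_pr_eq, h0] at hM
  simp at hM

theorem Good.weight_cons_of_not_pos {s : Proc A} (h : Good s) {M : Finset A}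
    (hM : ¬ 0 < P1 s M) (a : A) (tr : List (Finset A × A)) (N : Finset A) :
    weight s ((M, a) :: tr) N = 0 := by
  cases s with
  | nd l =>
    rw [weight_nd_cons, if_neg]
    intro h'
    rw [P1_nd, if_pos h'] at hM
    exact hM one_pos
  | pr l =>
    have h0 : l.filter (fun x => x.2.menu = M) = [] := by
      by_contra hne
      rw [h.P1_pr_eq] at hM
      refine hM (List.sum_pos _ ?_ (by simpa using hne))
      cases h with
      | pr _ _ hp _ _ =>
        intro r hr
        obtain ⟨x, hx, rfl⟩ := List.mem_map.1 hr
        exact hp x (List.mem_filter.1 hx).1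
    rw [h.weight_pr_cons, h0]
    rfl

theorem Good.not_mem {s : Proc A} (h : Good s) {M : Finset A} {a : A} (ha : a ∉ M) :
    after s M a = none ∧ ∀ tr N, weight s ((M, a) :: tr) N = 0 := by
  cases s with
  | nd l =>
    by_cases hl : menu (.nd l) = M
    · have h0 : step (.nd l) a = none := by rwa [step_eq_none_iff, hl]
      refine ⟨?_, fun tr N => ?_⟩
      · rw [after, h0, ite_self]
      · rw [weight_nd_cons, h0]
        simp
    · exact ⟨if_neg hl, fun tr N => by rw [weight_nd_cons, if_neg hl]⟩
  | pr l =>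
    have h0 : ∀ x ∈ l.filter (fun x => x.2.menu = M), step x.2 a = none := by
      intro x hx
      rw [List.mem_filter, decide_eq_true_iff] at hx
      cases h with
      | pr _ _ _ hn _ =>
        obtain ⟨l', hl'⟩ := hn x hx.1
        rw [hl'] at hx ⊢
        rwa [step_eq_none_iff, hx.2]
    refine ⟨?_, fun tr N => ?_⟩
    · simp only [after]
      rw [if_pos]
      rw [List.isEmpty_iff, List.flatMap_eq_nil_iff]
      intro x hx
      rw [h0 x hx]
    · rw [h.weight_pr_cons]
      refine List.sum_eq_zero fun r hr => ?_
      obtain ⟨x, hx, rfl⟩ := List.mem_map.1 hr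
      rw [h0 x hx]
      simp

theorem Good.exists_after {s : Proc A} (h : Good s) {M : Finset A} {a : A}
    (hM : 0 < P1 s M) (ha : a ∈ M) :
    ∃ s', after s M a = some s' ∧ Good s' ∧
      ∀ tr N, weight s ((M, a) :: tr) N = P1 s M * weight s' tr N := by
  cases s with
  | nd l =>
    have hl : menu (.nd l) = M := by
      by_contra hl
      rw [P1_nd, if_neg hl] at hM
      exact lt_irrefl _ hM
    obtain ⟨q, hq⟩ := Option.isSome_iff_exists.1 ((mem_menu_iff l a).1 (hl ▸ ha))
    refine ⟨q, ?_, h.of_step hq, fun tr N => ?_⟩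
    · rw [after, hq]
      exact if_pos hl
    · rw [weight_nd_cons, hq, if_pos hl, P1_nd, if_pos hl, one_mul]
      rfl
  | pr l =>
    have hstep : ∀ x ∈ l.filter (fun x => x.2.menu = M),
        0 < x.1 ∧ ∃ q, step x.2 a = some q ∧ Good q := by
      intro x hx
      rw [List.mem_filter, decide_eq_true_iff] at hx
      cases h with
      | pr _ _ hp hn hg =>
        obtain ⟨l', hl'⟩ := hn x hx.1
        have hgx := hg x hx.1
        refine ⟨hp x hx.1, ?_⟩
        rw [hl'] at hx hgx ⊢
        obtain ⟨q, hq⟩ := Option.isSome_iff_exists.1 ((mem_menu_iff l' a).1 (hx.2 ▸ ha))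
        exact ⟨q, hq, hgx.of_step hq⟩
    have hne := h.filter_menu_ne_nil hM
    have hw := h.weight_pr_cons M a
    rw [h.P1_pr_eq] at hM ⊢
    simp only [after]
    generalize l.filter (fun x => decide (x.2.menu = M)) = sel at *
    generalize (sel.map Prod.fst).sum = tot at *
    have hentries : sel.flatMap (fun x => match x.2.step a with
        | none => []
        | some q => flat (x.1 / tot) q) ≠ [] := by
      obtain ⟨x, hx⟩ := List.exists_mem_of_ne_nil _ hne
      obtain ⟨_, q, hq, hgq⟩ := hstep x hx
      intro h0
      have := List.flatMap_eq_nil_iff.1 h0 x hx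
      rw [hq] at this
      exact hgq.flat_ne_nil _ this
    have hmem : ∀ y ∈ sel.flatMap (fun x => match x.2.step a with
        | none => []
        | some q => flat (x.1 / tot) q), 0 < y.1 ∧ (∃ l', y.2 = .nd l') ∧ Good y.2 := by
      intro y hy
      obtain ⟨x, hx, hyx⟩ := List.mem_flatMap.1 hy
      obtain ⟨hpx, q, hq, hgq⟩ := hstep x hx
      rw [hq] at hyx
      exact hgq.of_mem_flat (div_pos hpx hM) hyx
    rw [if_neg]
    · refine ⟨_, rfl, .pr _ hentries ?_ ?_ ?_, fun tr N => ?_⟩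
      · exact fun y hy => (hmem y hy).1
      · exact fun y hy => (hmem y hy).2.1
      · exact fun y hy => (hmem y hy).2.2
      · rw [hw, weight_pr_apply, List.map_flatMap, List.flatMap_def, List.sum_flatten, List.map_map,
          ← List.sum_map_mul_left]
        congr 1
        refine List.map_congr_left fun x hx => ?_
        obtain ⟨_, q, hq, _⟩ := hstep x hx
        simp only [Function.comp_apply, hq, weight_pr_flat, Option.elim_some]
        field_simp
    · rwa [List.isEmpty_iff]

theorem pn_eq_of_weight_eq (tr : List (Finset A × A)) (M : Finset A) (s t : Proc A)
    (hs : Good s) (ht : Good t) (h : weight s = weight t) : Pn s tr M = Pn t tr M := by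
  have hP : ∀ M, P1 s M = P1 t M := fun M => by
    rw [← hs.weight_nil, ← ht.weight_nil, h]
  induction tr generalizing s t with
  | nil => rw [Pn, Pn, hP]
  | cons Ma tr ih =>
    obtain ⟨M₁, a⟩ := Ma
    rw [Pn, Pn, ← hP]
    split_ifs with hpos
    · by_cases ha : a ∈ M₁
      · obtain ⟨s', hs', hgs, hws⟩ := hs.exists_after hpos ha
        obtain ⟨t', ht', hgt, hwt⟩ := ht.exists_after (hP M₁ ▸ hpos) ha
        have hw : weight s' = weight t' := by
          funext tr N
          have := hws tr N
          rw [h, hwt, ← hP] at this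
          exact (mul_left_cancel₀ hpos.ne' this).symm
        rw [hs', ht', Option.bind_some, Option.bind_some]
        exact ih s' t' hgs hgt hw fun M => by rw [← hgs.weight_nil, ← hgt.weight_nil, hw]
      · rw [(hs.not_mem ha).1, (ht.not_mem ha).1]
    · rfl

theorem RTEquiv.weight_apply_eq (tr : List (Finset A × A)) (M : Finset A) (s t : Proc A)
    (hs : Good s) (ht : Good t) (h : RTEquiv s t) : weight s tr M = weight t tr M := by
  have hP : ∀ M, P1 s M = P1 t M := fun M => by simpa [Pn] using h [] M
  induction tr generalizing s t with
  | nil => rw [hs.weight_nil, ht.weight_nil, hP]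
  | cons Ma tr ih =>
    obtain ⟨M₁, a⟩ := Ma
    by_cases hpos : 0 < P1 s M₁
    · by_cases ha : a ∈ M₁
      · obtain ⟨s', hs', hgs, hws⟩ := hs.exists_after hpos ha
        obtain ⟨t', ht', hgt, hwt⟩ := ht.exists_after (hP M₁ ▸ hpos) ha
        have hst : RTEquiv s' t' := fun tr N => by
          have := h ((M₁, a) :: tr) N
          rwa [Pn, Pn, ← hP, if_pos hpos, if_pos hpos, hs', ht'] at this
        rw [hws, hwt, hP, ih s' t' hgs hgt hst fun M => by simpa [Pn] using hst [] M]
      · rw [(hs.not_mem ha).2, (ht.not_mem ha).2]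
    · rw [hs.weight_cons_of_not_pos hpos, ht.weight_cons_of_not_pos (hP M₁ ▸ hpos)]

theorem rtEquiv_iff_weight_eq {s t : Proc A} (hs : Good s) (ht : Good t) :
    RTEquiv s t ↔ weight s = weight t :=
  ⟨fun h => by funext tr M; exact h.weight_apply_eq tr M s t hs ht,
    fun h tr M => pn_eq_of_weight_eq tr M s t hs ht h⟩

end ConditionalProbability

section Priority

variable {A : Type} [DecidableEq A] [LT A] [DecidableRel ((· < ·) : A → A → Prop)]

/-- The maximal-priority actions of a menu. -/
def maxMenu (M : Finset A) : Finset A := M.filter (fun a => ¬ ∃ b ∈ M, a < b)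

theorem step_maxBranches (l : List (A × Proc A)) (a : A) :
    step (nd (maxBranches l)) a = if a ∈ maxMenu (menu (nd l)) then step (nd l) a else none := by
  have h : (∃ y ∈ l, a < y.1) ↔ ∃ b ∈ menu (nd l), a < b := by simp [menu]
  rw [maxBranches, step_filter (fun b => decide (¬ ∃ y ∈ l, b < y.1)), maxMenu]
  simp only [Finset.mem_filter, decide_eq_true_iff, h]
  by_cases ha : a ∈ menu (nd l)
  · simp only [ha, true_and]
  · rw [(step_eq_none_iff l a).2 ha, ite_self, ite_self]

theorem menu_maxBranches (l : List (A × Proc A)) :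
    menu (nd (maxBranches l)) = maxMenu (menu (nd l)) := by
  ext a
  rw [mem_menu_iff, step_maxBranches]
  split_ifs with h
  · rw [← mem_menu_iff]
    exact iff_of_true (Finset.mem_filter.1 h).1 h
  · simp [h]

/-- The action of the priority operator on ready-trace functionals. -/
noncomputable def thetaObs [Fintype A] (F : Obs A) : Obs A
  | [], N => ∑ M, if maxMenu M = N then F [] M else 0
  | Ma :: tr, N => ∑ M, if maxMenu M = Ma.1 ∧ Ma.2 ∈ Ma.1 then
      thetaObs (derive F M Ma.2) tr N else 0

variable [Fintype A]

theorem thetaObs_zero : thetaObs (0 : Obs A) = 0 := by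
  funext tr N
  induction tr with
  | nil => simp [thetaObs]
  | cons Ma tr ih => simp [thetaObs, derive_zero, ih]

theorem thetaObs_add (F G : Obs A) : thetaObs (F + G) = thetaObs F + thetaObs G := by
  funext tr N
  induction tr generalizing F G with
  | nil =>
    simp only [thetaObs, Pi.add_apply, ← Finset.sum_add_distrib]
    refine Finset.sum_congr rfl fun M _ => ?_
    split_ifs <;> simp
  | cons Ma tr ih =>
    simp only [thetaObs, Pi.add_apply, ← Finset.sum_add_distrib]
    refine Finset.sum_congr rfl fun M _ => ?_
    split_ifs <;> simp [derive_add, ih]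

theorem thetaObs_smul (c : ℝ) (F : Obs A) : thetaObs (c • F) = c • thetaObs F := by
  funext tr N
  induction tr generalizing F with
  | nil => simp [thetaObs, Finset.mul_sum]
  | cons Ma tr ih => simp [thetaObs, Finset.mul_sum, derive_smul, ih]

theorem thetaObs_sum {ι : Type*} (l : List ι) (w : ι → ℝ) (F : ι → Obs A) :
    thetaObs (l.map (fun x => w x • F x)).sum = (l.map (fun x => w x • thetaObs (F x))).sum := by
  induction l with
  | nil => exact thetaObs_zero
  | cons x l ih => simp [thetaObs_add, thetaObs_smul, ih]

theorem thetaObs_weight_nd {l m : List (A × Proc A)}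
    (h : List.Forall₂ (fun x y => y.1 = x.1 ∧ weight y.2 = thetaObs (weight x.2))
      (maxBranches l) m) :
    weight (nd m) = thetaObs (weight (nd l)) := by
  have hmenu := (menu_eq_of_forall₂ h fun _ _ h => h.1).trans (menu_maxBranches l)
  funext tr N
  rcases tr with _ | ⟨⟨M, a⟩, tr⟩
  · rw [weight_nd_nil, hmenu, thetaObs, Finset.sum_eq_single (menu (nd l))]
    · simp [weight_nd_nil]
    · intro M' _ hM'
      simp [weight_nd_nil, Ne.symm hM']
    · simp
  · rw [weight_nd_cons, hmenu, thetaObs, Finset.sum_eq_single (menu (nd l))]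
    · rw [derive_weight_nd, if_pos rfl]
      rcases step_of_forall₂ (R := fun _ p q => weight q = thetaObs (weight p)) h a with
        ⟨h₁, h₂⟩ | ⟨q, q', h₁, h₂, hq⟩
      · rw [step_maxBranches] at h₁
        rw [h₂]
        split_ifs at h₁ with ha
        · simp [h₁, thetaObs_zero]
        · have : ¬ (maxMenu (menu (nd l)) = M ∧ a ∈ M) := fun h => ha (h.1 ▸ h.2)
          simp [this]
      · rw [step_maxBranches] at h₁
        split_ifs at h₁ with ha
        rw [h₂, h₁, Option.elim_some, Option.elim_some, hq]
        have : (maxMenu (menu (nd l)) = M ∧ a ∈ M) ↔ maxMenu (menu (nd l)) = M :=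
          ⟨And.left, fun h => ⟨h, h ▸ ha⟩⟩
        simp only [this]
    · intro M' _ hM'
      rw [derive_weight_nd, if_neg hM'.symm, thetaObs_zero]
      simp
    · simp

theorem ThetaRel.weight_eq {q r : Proc A} (h : ThetaRel q r) :
    weight r = thetaObs (weight q) := by
  induction h with
  | nd l m hlen hact _ ih =>
    exact thetaObs_weight_nd (List.forall₂_iff_get.2
      ⟨hlen.symm, fun i h₁ h₂ => ⟨hact i h₁ h₂, ih i h₁ h₂⟩⟩)
  | pr l m hlen hw _ ih =>
    rw [weight_pr, weight_pr, thetaObs_sum]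
    exact sum_eq_of_forall₂ (List.forall₂_iff_get.2
      ⟨hlen.symm, fun i h₁ h₂ => by rw [hw i h₁ h₂, ih i h₁ h₂]⟩)

end Priority

section Parallel

variable {A : Type} [DecidableEq A]

/-- The menu of a parallel composition, in terms of the menus of its components. -/
def parMenu (L M₁ M₂ : Finset A) : Finset A := (M₁ ∩ M₂ ∩ L) ∪ (M₁ \ L) ∪ (M₂ \ L)

theorem step_syncBranches (L : Finset A) (l l' : List (A × Proc A)) (a : A) :
    step (nd (syncBranches L l l')) a =
      if a ∈ L ∧ a ∈ menu (nd l') then step (nd l) a else none := by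
  rw [syncBranches, step_filter (fun b => decide (b ∈ L) && (step (nd l') b).isSome)]
  simp [mem_menu_iff]

theorem step_freeBranches (L : Finset A) (l : List (A × Proc A)) (a : A) :
    step (nd (freeBranches L l)) a = if a ∈ L then none else step (nd l) a := by
  rw [freeBranches, step_filter (fun b => decide (b ∉ L))]
  simp

theorem menu_parallel {L : Finset A} {l l' m₁ m₂ m₃ : List (A × Proc A)}
    (h₁ : menu (nd m₁) = menu (nd (syncBranches L l l')))
    (h₂ : menu (nd m₂) = menu (nd (freeBranches L l)))
    (h₃ : menu (nd m₃) = menu (nd (freeBranches L l'))) :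
    menu (nd (m₁ ++ m₂ ++ m₃)) = parMenu L (menu (nd l)) (menu (nd l')) := by
  have happ : menu (nd (m₁ ++ m₂ ++ m₃)) = menu (nd m₁) ∪ menu (nd m₂) ∪ menu (nd m₃) := by
    simp [menu, List.toFinset_append]
  rw [happ, h₁, h₂, h₃]
  ext a
  simp only [Finset.mem_union, mem_menu_iff, step_syncBranches, step_freeBranches, parMenu,
    Finset.mem_inter, Finset.mem_sdiff]
  by_cases ha : a ∈ L <;> by_cases hl : (step (nd l') a).isSome <;> simp [ha, hl]

variable [Fintype A]

/-- The action of parallel composition on ready-trace functionals. -/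
noncomputable def parObs (L : Finset A) (F G : Obs A) : Obs A
  | [], N => ∑ M₁, ∑ M₂, if parMenu L M₁ M₂ = N then F [] M₁ * G [] M₂ else 0
  | Ma :: tr, N => ∑ M₁, ∑ M₂, if parMenu L M₁ M₂ = Ma.1 then
      if Ma.2 ∈ L then parObs L (derive F M₁ Ma.2) (derive G M₂ Ma.2) tr N
      else if Ma.2 ∈ M₁ then parObs L (derive F M₁ Ma.2) (restr G M₂) tr N
      else parObs L (restr F M₁) (derive G M₂ Ma.2) tr N
    else 0

theorem parObs_zero_left (L : Finset A) (G : Obs A) : parObs L 0 G = 0 := by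
  funext tr N
  induction tr generalizing G with
  | nil => simp [parObs]
  | cons Ma tr ih => simp [parObs, derive_zero, restr_zero, ih]

theorem parObs_zero_right (L : Finset A) (F : Obs A) : parObs L F 0 = 0 := by
  funext tr N
  induction tr generalizing F with
  | nil => simp [parObs]
  | cons Ma tr ih => simp [parObs, derive_zero, restr_zero, ih]

theorem parObs_add_left (L : Finset A) (F F' G : Obs A) :
    parObs L (F + F') G = parObs L F G + parObs L F' G := by
  funext tr N
  induction tr generalizing F F' G with
  | nil =>
    simp only [parObs, Pi.add_apply, ← Finset.sum_add_distrib]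
    refine Finset.sum_congr rfl fun _ _ => Finset.sum_congr rfl fun _ _ => ?_
    split_ifs <;> simp [add_mul]
  | cons Ma tr ih =>
    simp only [parObs, Pi.add_apply, ← Finset.sum_add_distrib]
    refine Finset.sum_congr rfl fun _ _ => Finset.sum_congr rfl fun _ _ => ?_
    split_ifs <;> simp [derive_add, restr_add, ih]

theorem parObs_add_right (L : Finset A) (F G G' : Obs A) :
    parObs L F (G + G') = parObs L F G + parObs L F G' := by
  funext tr N
  induction tr generalizing F G G' with
  | nil =>
    simp only [parObs, Pi.add_apply, ← Finset.sum_add_distrib]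
    refine Finset.sum_congr rfl fun _ _ => Finset.sum_congr rfl fun _ _ => ?_
    split_ifs <;> simp [mul_add]
  | cons Ma tr ih =>
    simp only [parObs, Pi.add_apply, ← Finset.sum_add_distrib]
    refine Finset.sum_congr rfl fun _ _ => Finset.sum_congr rfl fun _ _ => ?_
    split_ifs <;> simp [derive_add, restr_add, ih]

theorem parObs_smul_left (L : Finset A) (c : ℝ) (F G : Obs A) :
    parObs L (c • F) G = c • parObs L F G := by
  funext tr N
  induction tr generalizing F G with
  | nil => simp [parObs, Finset.mul_sum, mul_assoc]
  | cons Ma tr ih => simp [parObs, Finset.mul_sum, derive_smul, restr_smul, ih]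

theorem parObs_smul_right (L : Finset A) (c : ℝ) (F G : Obs A) :
    parObs L F (c • G) = c • parObs L F G := by
  funext tr N
  induction tr generalizing F G with
  | nil => simp [parObs, Finset.mul_sum, mul_left_comm]
  | cons Ma tr ih => simp [parObs, Finset.mul_sum, derive_smul, restr_smul, ih]

theorem parObs_sum_left {ι : Type*} (L : Finset A) (l : List ι) (w : ι → ℝ) (F : ι → Obs A)
    (G : Obs A) : parObs L (l.map (fun x => w x • F x)).sum G =
      (l.map (fun x => w x • parObs L (F x) G)).sum := by
  induction l with
  | nil => exact parObs_zero_left L G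
  | cons x l ih => simp [parObs_add_left, parObs_smul_left, ih]

theorem parObs_sum_right {ι : Type*} (L : Finset A) (l : List ι) (w : ι → ℝ) (F : Obs A)
    (G : ι → Obs A) : parObs L F (l.map (fun x => w x • G x)).sum =
      (l.map (fun x => w x • parObs L F (G x))).sum := by
  induction l with
  | nil => exact parObs_zero_right L F
  | cons x l ih => simp [parObs_add_right, parObs_smul_right, ih]

theorem parObs_weight_nd_nil (L : Finset A) (l l' : List (A × Proc A)) (N : Finset A) :
    parObs L (weight (nd l)) (weight (nd l')) [] N =
      if parMenu L (menu (nd l)) (menu (nd l')) = N then 1 else 0 := by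
  rw [parObs, Finset.sum_eq_single (menu (nd l)), Finset.sum_eq_single (menu (nd l'))]
  · simp [weight_nd_nil]
  · intro M _ hM
    simp [weight_nd_nil, hM.symm]
  · simp
  · intro M _ hM
    simp [weight_nd_nil, hM.symm]
  · simp

theorem parObs_weight_nd_cons (L : Finset A) (l l' : List (A × Proc A)) (M : Finset A) (a : A)
    (tr : List (Finset A × A)) (N : Finset A) :
    parObs L (weight (nd l)) (weight (nd l')) ((M, a) :: tr) N =
      if parMenu L (menu (nd l)) (menu (nd l')) = M then
        if a ∈ L then parObs L ((step (nd l) a).elim 0 weight) ((step (nd l') a).elim 0 weight) tr N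
        else if a ∈ menu (nd l) then
          parObs L ((step (nd l) a).elim 0 weight) (weight (nd l')) tr N
        else parObs L (weight (nd l)) ((step (nd l') a).elim 0 weight) tr N
      else 0 := by
  rw [parObs, Finset.sum_eq_single (menu (nd l)), Finset.sum_eq_single (menu (nd l'))]
  · simp [derive_weight_nd, restr_weight_nd]
  · intro M _ hM
    simp [derive_weight_nd, restr_weight_nd, hM.symm, parObs_zero_right]
  · simp
  · intro M _ hM
    simp [derive_weight_nd, restr_weight_nd, hM.symm, parObs_zero_left]
  · simp

theorem parObs_weight_nd {L : Finset A} {l l' m₁ m₂ m₃ : List (A × Proc A)}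
    (h₁ : List.Forall₂ (fun x y => y.1 = x.1 ∧ ∀ q', step (nd l') x.1 = some q' →
      weight y.2 = parObs L (weight x.2) (weight q')) (syncBranches L l l') m₁)
    (h₂ : List.Forall₂ (fun x y => y.1 = x.1 ∧
      weight y.2 = parObs L (weight x.2) (weight (nd l'))) (freeBranches L l) m₂)
    (h₃ : List.Forall₂ (fun x y => y.1 = x.1 ∧
      weight y.2 = parObs L (weight (nd l)) (weight x.2)) (freeBranches L l') m₃) :
    weight (nd (m₁ ++ m₂ ++ m₃)) = parObs L (weight (nd l)) (weight (nd l')) := by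
  have hmenu := menu_parallel (menu_eq_of_forall₂ h₁ fun _ _ h => h.1)
    (menu_eq_of_forall₂ h₂ fun _ _ h => h.1) (menu_eq_of_forall₂ h₃ fun _ _ h => h.1)
  funext tr N
  rcases tr with _ | ⟨⟨M, a⟩, tr⟩
  · rw [weight_nd_nil, hmenu, parObs_weight_nd_nil]
  rw [weight_nd_cons, hmenu, parObs_weight_nd_cons, step_append, step_append]
  congr 1
  have s₁ := step_of_forall₂ (R := fun b p q => ∀ q', step (nd l') b = some q' →
      weight q = parObs L (weight p) (weight q')) h₁ a
  have s₂ := step_of_forall₂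
    (R := fun _ p q => weight q = parObs L (weight p) (weight (nd l'))) h₂ a
  have s₃ := step_of_forall₂
    (R := fun _ p q => weight q = parObs L (weight (nd l)) (weight p)) h₃ a
  rw [step_syncBranches] at s₁
  rw [step_freeBranches] at s₂ s₃
  by_cases ha : a ∈ L
  · rw [if_pos ha]
    have t₂ : step (nd m₂) a = none := by simpa [ha] using s₂
    have t₃ : step (nd m₃) a = none := by simpa [ha] using s₃
    rw [t₂, t₃, Option.or_none, Option.or_none]
    rcases s₁ with ⟨h, h'⟩ | ⟨q, q', h, h', hq⟩
    · rw [h', Option.elim_none]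
      split_ifs at h with hb
      · rw [h, Option.elim_none, parObs_zero_left]
      · rw [(step_eq_none_iff l' a).2 fun h => hb ⟨ha, h⟩, Option.elim_none, parObs_zero_right]
    · split_ifs at h with hb
      obtain ⟨p', hp'⟩ := Option.isSome_iff_exists.1 ((mem_menu_iff l' a).1 hb.2)
      rw [h', h, hp', Option.elim_some, Option.elim_some, Option.elim_some, hq p' hp']
  · have t₁ : step (nd m₁) a = none := by simpa [ha] using s₁
    rw [if_neg ha] at s₂ s₃
    rw [t₁, Option.none_or, if_neg ha]
    rcases s₂ with ⟨h, h'⟩ | ⟨q, q', h, h', hq⟩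
    · rw [h', Option.none_or, if_neg ((step_eq_none_iff l a).1 h)]
      rcases s₃ with ⟨k, k'⟩ | ⟨q, q', k, k', hq⟩
      · rw [k, k', Option.elim_none, parObs_zero_right]
      · rw [k, k', Option.elim_some, Option.elim_some, hq]
    · have hm : a ∈ menu (nd l) := by rw [mem_menu_iff, h]; rfl
      rw [h', h, if_pos hm, Option.some_or, Option.elim_some, Option.elim_some, hq]

theorem ParRel.weight_eq {L : Finset A} {p q r : Proc A} (h : ParRel L p q r) :
    weight r = parObs L (weight p) (weight q) := by
  induction h with
  | ndnd l l' m₁ m₂ m₃ len₁ act₁ _ len₂ act₂ _ len₃ act₃ _ ih₁ ih₂ ih₃ =>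
    exact parObs_weight_nd
      (List.forall₂_iff_get.2 ⟨len₁.symm, fun i h h' => ⟨act₁ i h h', ih₁ i h h'⟩⟩)
      (List.forall₂_iff_get.2 ⟨len₂.symm, fun i h h' => ⟨act₂ i h h', ih₂ i h h'⟩⟩)
      (List.forall₂_iff_get.2 ⟨len₃.symm, fun i h h' => ⟨act₃ i h h', ih₃ i h h'⟩⟩)
  | prnd l q m _ hlen hw _ ih =>
    rw [weight_pr, weight_pr, parObs_sum_left]
    exact sum_eq_of_forall₂ (List.forall₂_iff_get.2
      ⟨hlen.symm, fun i h h' => by rw [hw i h h', ih i h h']⟩)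
  | ndpr q l m _ hlen hw _ ih =>
    rw [weight_pr, weight_pr, parObs_sum_right]
    exact sum_eq_of_forall₂ (List.forall₂_iff_get.2
      ⟨hlen.symm, fun i h h' => by rw [hw i h h', ih i h h']⟩)
  | prpr l l' m hlen hw _ ih =>
    have hsum : parObs L (weight (pr l)) (weight (pr l')) =
        ((l.flatMap (fun x => l'.map (fun x' => (x, x')))).map (fun z =>
          (z.1.1 * z.2.1) • parObs L (weight z.1.2) (weight z.2.2))).sum := by
      rw [weight_pr, weight_pr, parObs_sum_left, List.map_flatMap, List.flatMap_def,
        List.sum_flatten, List.map_map]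
      congr 1
      refine List.map_congr_left fun x _ => ?_
      rw [parObs_sum_right, List.smul_sum, List.map_map, Function.comp_apply, List.map_map]
      simp [Function.comp_def, mul_smul]
    rw [hsum, weight_pr]
    exact sum_eq_of_forall₂ (List.forall₂_iff_get.2
      ⟨hlen.symm, fun i h h' => by rw [hw i h h', ih i h h']⟩)

end Parallel

section Goodness

variable {A : Type} [DecidableEq A]

theorem ParRel.exists_nd {L : Finset A} {p q r : Proc A} (h : ParRel L p q r)
    (hp : ∃ l, p = .nd l) (hq : ∃ l, q = .nd l) : ∃ m, r = .nd m := by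
  obtain ⟨l, rfl⟩ := hp
  obtain ⟨l', rfl⟩ := hq
  cases h
  exact ⟨_, rfl⟩

theorem ParRel.good {L : Finset A} {p q r : Proc A} (h : ParRel L p q r)
    (hp : Good p) (hq : Good q) : Good r := by
  induction h with
  | ndnd l l' m₁ m₂ m₃ len₁ act₁ _ len₂ act₂ _ len₃ act₃ _ ih₁ ih₂ ih₃ =>
    have hl : ∀ x ∈ l, Good x.2 := by cases hp; assumption
    have hl' : ∀ x ∈ l', Good x.2 := by cases hq; assumption
    have g₁ : Good (.nd m₁) := .nd_of_get fun i hi => by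
      have hi' : i < (syncBranches L l l').length := len₁ ▸ hi
      have hmem := List.mem_filter.1 (List.get_mem (syncBranches L l l') ⟨i, hi'⟩)
      have hsome := (Bool.and_eq_true_iff.1 hmem.2).2
      obtain ⟨q', hq'⟩ := Option.isSome_iff_exists.1 hsome
      exact ih₁ i hi' hi q' hq' (hl _ hmem.1) (hq.of_step hq')
    have g₂ : Good (.nd m₂) := .nd_of_get fun i hi => by
      have hi' : i < (freeBranches L l).length := len₂ ▸ hi
      exact ih₂ i hi' hi (hl _ (List.mem_filter.1 (List.get_mem _ _)).1) hq
    have g₃ : Good (.nd m₃) := .nd_of_get fun i hi => by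
      have hi' : i < (freeBranches L l').length := len₃ ▸ hi
      exact ih₃ i hi' hi hp (hl' _ (List.mem_filter.1 (List.get_mem _ _)).1)
    cases g₁ with | nd _ g₁ =>
    cases g₂ with | nd _ g₂ =>
    cases g₃ with | nd _ g₃ =>
    refine .nd _ fun x hx => ?_
    rcases List.mem_append.1 hx with hx | hx
    · exact (List.mem_append.1 hx).elim (g₁ x) (g₂ x)
    · exact g₃ x hx
  | prnd l q m hq' hlen hw hrel ih =>
    cases hp with | pr _ hne hpos hnd hg =>
    refine .pr_of_get (hlen ▸ List.length_pos_of_ne_nil hne) fun i hi => ?_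
    have hi' : i < l.length := hlen ▸ hi
    have hx := List.get_mem l ⟨i, hi'⟩
    refine ⟨hw i hi' hi ▸ hpos _ hx, (hrel i hi' hi).exists_nd (hnd _ hx) ?_,
      ih i hi' hi (hg _ hx) hq⟩
    cases q with
    | nd l => exact ⟨l, rfl⟩
    | pr l => exact absurd rfl (hq' l)
  | ndpr q l m hq' hlen hw hrel ih =>
    cases hq with | pr _ hne hpos hnd hg =>
    refine .pr_of_get (hlen ▸ List.length_pos_of_ne_nil hne) fun i hi => ?_
    have hi' : i < l.length := hlen ▸ hi
    have hx := List.get_mem l ⟨i, hi'⟩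
    refine ⟨hw i hi' hi ▸ hpos _ hx, (hrel i hi' hi).exists_nd ?_ (hnd _ hx),
      ih i hi' hi hp (hg _ hx)⟩
    cases q with
    | nd l => exact ⟨l, rfl⟩
    | pr l => exact absurd rfl (hq' l)
  | prpr l l' m hlen hw hrel ih =>
    cases hp with | pr _ hne hpos hnd hg =>
    cases hq with | pr _ hne' hpos' hnd' hg' =>
    refine .pr_of_get ?_ fun i hi => ?_
    · obtain ⟨x, hx⟩ := List.exists_mem_of_ne_nil _ hne
      obtain ⟨x', hx'⟩ := List.exists_mem_of_ne_nil _ hne'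
      rw [hlen]
      exact List.length_pos_of_mem
        (List.mem_flatMap.2 ⟨x, hx, List.mem_map.2 ⟨x', hx', rfl⟩⟩)
    · have hi' := hlen ▸ hi
      have hmem := List.get_mem (l.flatMap (fun x => l'.map (fun x' => (x, x')))) ⟨i, hi'⟩
      obtain ⟨x, hx, hmem⟩ := List.mem_flatMap.1 hmem
      obtain ⟨x', hx', hxx'⟩ := List.mem_map.1 hmem
      have hwi := hw i hi' hi
      have hri := hrel i hi' hi
      have ihi := ih i hi' hi
      rw [← hxx'] at hwi hri ihi
      exact ⟨hwi ▸ mul_pos (hpos x hx) (hpos' x' hx'), hri.exists_nd (hnd x hx) (hnd' x' hx'),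
        ihi (hg x hx) (hg' x' hx')⟩

variable [LT A] [DecidableRel ((· < ·) : A → A → Prop)] [Fintype A]

theorem Den.good {t : CSPp A} {q : Proc A} (h : Den t q) (ht : CSPp.WFt t) : Good q := by
  induction h with
  | delta => exact .nd [] (by simp)
  | ext l m hlen _ _ ih =>
    cases ht with | ext _ _ hl =>
    refine .nd_of_get fun i hi => ?_
    exact ih i (hlen ▸ hi) hi (hl _ (List.get_mem _ _))
  | prob l m hlen hw _ ih =>
    cases ht with | prob _ hpos hsum hl =>
    have hm : ∀ x ∈ m, 0 < x.1 ∧ Good x.2 := by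
      intro x hx
      obtain ⟨⟨i, hi⟩, rfl⟩ := List.mem_iff_get.1 hx
      have hi' : i < l.length := hlen ▸ hi
      exact ⟨hw i hi' hi ▸ (hpos _ (List.get_mem _ _)).1, ih i hi' hi (hl _ (List.get_mem _ _))⟩
    refine .pr_flatMap_pflat ?_ (fun x hx => (hm x hx).1) (fun x hx => (hm x hx).2)
    rintro rfl
    rw [List.length_nil, eq_comm, List.length_eq_zero_iff] at hlen
    rw [hlen] at hsum
    simp at hsum
  | theta p q q' _ hrel ih =>
    cases ht with | theta _ hp => exact hrel.good (ih hp)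
  | par p₁ p₂ q₁ q₂ r _ _ hrel ih₁ ih₂ =>
    cases ht with | par _ _ h₁ h₂ => exact hrel.good (ih₁ h₁) (ih₂ h₂)
  | parL L p₁ p₂ q₁ q₂ r _ _ hrel ih₁ ih₂ =>
    cases ht with | parL _ _ _ h₁ h₂ => exact hrel.good (ih₁ h₁) (ih₂ h₂)

end Goodness

section Congruence

variable {A : Type} [DecidableEq A] [LT A] [DecidableRel ((· < ·) : A → A → Prop)] [Fintype A]

/-- All denotations of the two terms have the same ready-trace functional. -/
def WeightEquiv (s t : CSPp A) : Prop :=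
  ∀ ps pt : Proc A, Den s ps → Den t pt → weight ps = weight pt

theorem cspEquiv_iff_weightEquiv {s t : CSPp A} (hs : CSPp.WFt s) (ht : CSPp.WFt t) :
    CSPEquiv s t ↔ WeightEquiv s t :=
  forall_congr' fun _ => forall_congr' fun _ => forall_congr' fun hds => forall_congr' fun hdt =>
    rtEquiv_iff_weight_eq (hds.good hs) (hdt.good ht)

theorem forall₂_of_get_den {B : Type*} {l l' : List (B × CSPp A)} {m m' : List (B × Proc A)}
    (h : List.Forall₂ (fun x y => x.1 = y.1 ∧ WeightEquiv x.2 y.2) l l')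
    (hlen : m.length = l.length)
    (hlab : ∀ i (hi : i < l.length) (hi' : i < m.length), (m.get ⟨i, hi'⟩).1 = (l.get ⟨i, hi⟩).1)
    (hden : ∀ i (hi : i < l.length) (hi' : i < m.length),
      Den (l.get ⟨i, hi⟩).2 (m.get ⟨i, hi'⟩).2)
    (hlen' : m'.length = l'.length)
    (hlab' : ∀ i (hi : i < l'.length) (hi' : i < m'.length),
      (m'.get ⟨i, hi'⟩).1 = (l'.get ⟨i, hi⟩).1)
    (hden' : ∀ i (hi : i < l'.length) (hi' : i < m'.length),
      Den (l'.get ⟨i, hi⟩).2 (m'.get ⟨i, hi'⟩).2) :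
    List.Forall₂ (fun x y => y.1 = x.1 ∧ weight x.2 = weight y.2) m m' := by
  obtain ⟨hll, hget⟩ := List.forall₂_iff_get.1 h
  refine List.forall₂_iff_get.2 ⟨by rw [hlen, hlen', hll], fun i hi hi' => ?_⟩
  have hl : i < l.length := hlen ▸ hi
  have hl' : i < l'.length := hlen' ▸ hi'
  obtain ⟨h₁, h₂⟩ := hget i hl hl'
  exact ⟨by rw [hlab i hl hi, hlab' i hl' hi', h₁], h₂ _ _ (hden i hl hi) (hden' i hl' hi')⟩

theorem WeightEquiv.ext {l l' : List (A × CSPp A)}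
    (h : List.Forall₂ (fun x y => x.1 = y.1 ∧ WeightEquiv x.2 y.2) l l') :
    WeightEquiv (.ext l) (.ext l') := by
  intro ps pt hs ht
  cases hs with | ext _ m hlen hlab hden =>
  cases ht with | ext _ m' hlen' hlab' hden' =>
  exact weight_nd_congr (forall₂_of_get_den h hlen hlab hden hlen' hlab' hden')

theorem WeightEquiv.prob {l l' : List (ℝ × CSPp A)}
    (h : List.Forall₂ (fun x y => x.1 = y.1 ∧ WeightEquiv x.2 y.2) l l') :
    WeightEquiv (.prob l) (.prob l') := by
  intro ps pt hs ht
  cases hs with | prob _ m hlen hlab hden =>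
  cases ht with | prob _ m' hlen' hlab' hden' =>
  rw [weight_pr_flatMap_pflat, weight_pr_flatMap_pflat]
  exact (sum_eq_of_forall₂ ((forall₂_of_get_den h hlen hlab hden hlen' hlab' hden').imp
    fun x y hxy => by rw [hxy.1, hxy.2])).symm

theorem WeightEquiv.theta {s t : CSPp A} (h : WeightEquiv s t) :
    WeightEquiv (.theta s) (.theta t) := by
  intro ps pt hs ht
  cases hs with | theta _ q _ hq hrel =>
  cases ht with | theta _ q' _ hq' hrel' =>
  rw [hrel.weight_eq, hrel'.weight_eq, h q q' hq hq']

theorem WeightEquiv.parL {s s' t t' : CSPp A} (L : Finset A) (h : WeightEquiv s t)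
    (h' : WeightEquiv s' t') : WeightEquiv (.parL L s s') (.parL L t t') := by
  intro ps pt hs ht
  cases hs with | parL _ _ _ p₁ p₂ _ hp₁ hp₂ hrel =>
  cases ht with | parL _ _ _ q₁ q₂ _ hq₁ hq₂ hrel' =>
  rw [hrel.weight_eq, hrel'.weight_eq, h _ _ hp₁ hq₁, h' _ _ hp₂ hq₂]

theorem WeightEquiv.par {s s' t t' : CSPp A} (h : WeightEquiv s t)
    (h' : WeightEquiv s' t') : WeightEquiv (.par s s') (.par t t') := by
  intro ps pt hs ht
  cases hs with | par _ _ p₁ p₂ _ hp₁ hp₂ hrel =>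
  cases ht with | par _ _ q₁ q₂ _ hq₁ hq₂ hrel' =>
  rw [hrel.weight_eq, hrel'.weight_eq, h _ _ hp₁ hq₁, h' _ _ hp₂ hq₂]

theorem WeightEquiv.refl (t : CSPp A) : WeightEquiv t t := by
  intro ps pt hs ht
  induction hs generalizing pt with
  | delta => cases ht; rfl
  | ext l m hlen hlab _ ih =>
    cases ht with | ext _ m' hlen' hlab' hden' =>
    refine weight_nd_congr (List.forall₂_iff_get.2 ⟨by rw [hlen, hlen'], fun i hi hi' => ?_⟩)
    have hl : i < l.length := hlen ▸ hi
    exact ⟨by rw [hlab i hl hi, hlab' i hl hi'], ih i hl hi _ (hden' i hl hi')⟩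
  | prob l m hlen hlab _ ih =>
    cases ht with | prob _ m' hlen' hlab' hden' =>
    rw [weight_pr_flatMap_pflat, weight_pr_flatMap_pflat]
    refine (sum_eq_of_forall₂
      (List.forall₂_iff_get.2 ⟨by rw [hlen, hlen'], fun i hi hi' => ?_⟩)).symm
    have hl : i < l.length := hlen ▸ hi
    rw [hlab i hl hi, hlab' i hl hi', ih i hl hi _ (hden' i hl hi')]
  | theta _ q _ _ hrel ih =>
    cases ht with | theta _ q' _ hq' hrel' =>
    rw [hrel.weight_eq, hrel'.weight_eq, ih q' hq']
  | par _ _ _ _ _ _ _ hrel ih₁ ih₂ =>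
    cases ht with | par _ _ q₁ q₂ _ hq₁ hq₂ hrel' =>
    rw [hrel.weight_eq, hrel'.weight_eq, ih₁ _ hq₁, ih₂ _ hq₂]
  | parL _ _ _ _ _ _ _ _ hrel ih₁ ih₂ =>
    cases ht with | parL _ _ _ q₁ q₂ _ hq₁ hq₂ hrel' =>
    rw [hrel.weight_eq, hrel'.weight_eq, ih₁ _ hq₁, ih₂ _ hq₂]

theorem WeightEquiv.forall₂_insert {B : Type*} {s t : CSPp A} (h : WeightEquiv s t)
    (pre : List (B × CSPp A)) (b : B) (suf : List (B × CSPp A)) :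
    List.Forall₂ (fun x y => x.1 = y.1 ∧ WeightEquiv x.2 y.2)
      (pre ++ (b, s) :: suf) (pre ++ (b, t) :: suf) := by
  have hrefl : ∀ l : List (B × CSPp A),
      List.Forall₂ (fun x y => x.1 = y.1 ∧ WeightEquiv x.2 y.2) l l := fun l =>
    List.forall₂_same.2 fun x _ => ⟨rfl, .refl x.2⟩
  exact List.rel_append (hrefl pre) (.cons ⟨rfl, h⟩ (hrefl suf))

theorem WeightEquiv.fill {s t : CSPp A} (h : WeightEquiv s t) (C : CSPp.Ctx A) :
    WeightEquiv (C.fill s) (C.fill t) := by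
  induction C with
  | hole => exact h
  | ext pre a _ suf ih => exact .ext (ih.forall₂_insert pre a suf)
  | prob pre w _ suf ih => exact .prob (ih.forall₂_insert pre w suf)
  | theta _ ih => exact ih.theta
  | parl _ q ih => exact ih.par (.refl q)
  | parr q _ ih => exact .par (.refl q) ih
  | parLl L _ q ih => exact ih.parL L (.refl q)
  | parLr L q _ ih => exact .parL L (.refl q) ih

end Congruence

end Proc

/-- Probabilistic ready trace equivalence is a congruence for all CSP_p
operators: if `p ≈_O p̄` then `C[p] ≈_O C[p̄]` for every CSP_p context `C`. -/
theorem rtEquiv_congruence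
    {A : Type} [DecidableEq A] [LT A]
    [DecidableRel ((· < ·) : A → A → Prop)] [Fintype A]
    (p pbar : CSPp A) (hp : CSPp.WFt p) (hpbar : CSPp.WFt pbar)
    (h : Proc.CSPEquiv p pbar)
    (C : CSPp.Ctx A) (hC : ∀ q : CSPp A, CSPp.WFt q → CSPp.WFt (C.fill q)) :
    Proc.CSPEquiv (C.fill p) (C.fill pbar) := by
  have hfill := ((Proc.cspEquiv_iff_weightEquiv hp hpbar).1 h).fill C
  exact (Proc.cspEquiv_iff_weightEquiv (hC p hp) (hC pbar hpbar)).2 hfill
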